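/- arXiv:2307.14741 — 2 statements merged into one kernel-verified Lean document; each statement's English description precedes it below -/
import Mathlib

section
/- In the SCI setting, for any nonzero x, the value g(x) := min over P_{AB} ∈ A_Split of xᵀ (C_F*(P_{AB}))^{-1} x equals max over ω ∈ [0,1] of xᵀ H_SCI(ω) x. -/
open Matrix

namespace SplitCovariance

variable {n : ℕ}

lemma dotProduct_mulVec_comm {P : Matrix (Fin n) (Fin n) ℝ} (hP : P.IsHermitian)
    (a b : Fin n → ℝ) : a ⬝ᵥ P *ᵥ b = b ⬝ᵥ P *ᵥ a := by
  have h : Pᵀ = P := by simpa [IsHermitian, conjTranspose_eq_transpose_of_trivial] using hP.eq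
  rw [dotProduct_comm, ← vecMul_transpose, h, ← dotProduct_mulVec]

lemma dotProduct_transpose_mulVec_swap (P : Matrix (Fin n) (Fin n) ℝ) (a b : Fin n → ℝ) :
    b ⬝ᵥ Pᵀ *ᵥ a = a ⬝ᵥ P *ᵥ b := by
  rw [mulVec_transpose, dotProduct_comm, ← dotProduct_mulVec]

lemma quadratic_fromBlocks (A B P : Matrix (Fin n) (Fin n) ℝ) (a b : Fin n → ℝ) :
    Sum.elim a b ⬝ᵥ fromBlocks A P Pᵀ B *ᵥ Sum.elim a b
      = a ⬝ᵥ A *ᵥ a + 2 * (a ⬝ᵥ P *ᵥ b) + b ⬝ᵥ B *ᵥ b := by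
  simp only [fromBlocks_mulVec, sumElim_dotProduct_sumElim, Sum.elim_comp_inl,
    Sum.elim_comp_inr, dotProduct_add, dotProduct_transpose_mulVec_swap]
  ring

lemma isHermitian_fromBlocks_transpose {A B : Matrix (Fin n) (Fin n) ℝ} (hA : A.IsHermitian)
    (hB : B.IsHermitian) (P : Matrix (Fin n) (Fin n) ℝ) :
    (fromBlocks A P Pᵀ B).IsHermitian :=
  IsHermitian.fromBlocks hA (by simp) hB

lemma posSemidef_fromBlocks_iff {A B : Matrix (Fin n) (Fin n) ℝ} (hA : A.IsHermitian)
    (hB : B.IsHermitian) (P : Matrix (Fin n) (Fin n) ℝ) :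
    (fromBlocks A P Pᵀ B).PosSemidef ↔
      ∀ a b : Fin n → ℝ, 0 ≤ a ⬝ᵥ A *ᵥ a + 2 * (a ⬝ᵥ P *ᵥ b) + b ⬝ᵥ B *ᵥ b := by
  constructor
  · intro h a b
    have := h.dotProduct_mulVec_nonneg (Sum.elim a b)
    rwa [star_trivial, quadratic_fromBlocks] at this
  · intro h
    refine PosSemidef.of_dotProduct_mulVec_nonneg (isHermitian_fromBlocks_transpose hA hB P) ?_
    intro z
    rw [star_trivial, ← Sum.elim_comp_inl_inr z, quadratic_fromBlocks]
    exact h _ _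

lemma quadratic_pos {A : Matrix (Fin n) (Fin n) ℝ} (hA : A.PosDef) {a : Fin n → ℝ}
    (ha : a ≠ 0) : 0 < a ⬝ᵥ A *ᵥ a := by
  simpa using hA.dotProduct_mulVec_pos ha

lemma quadratic_nonneg {A : Matrix (Fin n) (Fin n) ℝ} (hA : A.PosDef) (a : Fin n → ℝ) :
    0 ≤ a ⬝ᵥ A *ᵥ a := by
  simpa using hA.posSemidef.dotProduct_mulVec_nonneg a

lemma posDef_fromBlocks_add {PA PB QA QB P : Matrix (Fin n) (Fin n) ℝ}
    (hQA : QA.PosDef) (hQB : QB.PosDef) (hP : (fromBlocks PA P Pᵀ PB).PosSemidef) :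
    (fromBlocks (PA + QA) P Pᵀ (PB + QB)).PosDef := by
  have hQ : (fromBlocks QA 0 (0 : Matrix (Fin n) (Fin n) ℝ)ᵀ QB).PosDef := by
    refine PosDef.of_dotProduct_mulVec_pos
      (isHermitian_fromBlocks_transpose hQA.isHermitian hQB.isHermitian 0) ?_
    intro z hz
    rw [star_trivial, ← Sum.elim_comp_inl_inr z, quadratic_fromBlocks]
    have h1 := quadratic_nonneg hQA (z ∘ Sum.inl)
    have h2 := quadratic_nonneg hQB (z ∘ Sum.inr)
    by_cases ha : z ∘ Sum.inl = 0
    · have hb : z ∘ Sum.inr ≠ 0 := by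
        intro hb
        apply hz
        rw [← Sum.elim_comp_inl_inr z, ha, hb]
        ext i
        cases i <;> rfl
      have := quadratic_pos hQB hb
      simp only [zero_mulVec, dotProduct_zero]
      linarith
    · have := quadratic_pos hQA ha
      simp only [zero_mulVec, dotProduct_zero]
      linarith
  have := hQ.posSemidef_add hP
  simpa [fromBlocks_add, add_comm] using this

/-- The Bar-Shalom–Campo fused covariance. -/
noncomputable def fusedCov (CA CB P : Matrix (Fin n) (Fin n) ℝ) : Matrix (Fin n) (Fin n) ℝ :=
  CA - (CA - P) * (CA + CB - P - Pᵀ)⁻¹ * (CA - Pᵀ)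

lemma isUnit_det_innovation {CA CB P : Matrix (Fin n) (Fin n) ℝ}
    (hM : (fromBlocks CA P Pᵀ CB).PosDef) : IsUnit (CA + CB - P - Pᵀ).det := by
  rw [← isUnit_iff_isUnit_det, ← mulVec_injective_iff_isUnit]
  refine (injective_iff_map_eq_zero (mulVecLin (CA + CB - P - Pᵀ))).2 fun w hw => ?_
  by_contra hne
  have hz : Sum.elim w (-w) ≠ 0 := by
    intro h
    exact hne (by ext i; simpa using congrFun h (Sum.inl i))
  have h1 := hM.dotProduct_mulVec_pos hz
  rw [star_trivial, quadratic_fromBlocks] at h1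
  have h2 : w ⬝ᵥ (CA + CB - P - Pᵀ) *ᵥ w = 0 := by
    rw [mulVecLin_apply] at hw
    rw [hw, dotProduct_zero]
  simp only [sub_mulVec, add_mulVec, dotProduct_sub, dotProduct_add,
    dotProduct_transpose_mulVec_swap] at h2
  simp only [mulVec_neg, dotProduct_neg, neg_dotProduct, neg_neg] at h1
  linarith

lemma fusedCov_mulVec {CA CB P : Matrix (Fin n) (Fin n) ℝ}
    (hM : (fromBlocks CA P Pᵀ CB).PosDef) {x u v : Fin n → ℝ}
    (hu : CA *ᵥ u + P *ᵥ v = x) (hv : Pᵀ *ᵥ u + CB *ᵥ v = x) :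
    fusedCov CA CB P *ᵥ (u + v) = x := by
  have h1 : (CA - Pᵀ) *ᵥ (u + v) = (CA + CB - P - Pᵀ) *ᵥ v := by
    have h := hu.trans hv.symm
    simp only [sub_mulVec, add_mulVec, mulVec_add]
    linear_combination (exp := 1) h
  rw [fusedCov, sub_mulVec, ← mulVec_mulVec, h1, mulVec_mulVec, Matrix.mul_assoc,
    nonsing_inv_mul _ (isUnit_det_innovation hM), Matrix.mul_one, ← hu]
  simp only [sub_mulVec, mulVec_add]
  abel

lemma exists_joint_solution {CA CB P : Matrix (Fin n) (Fin n) ℝ}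
    (hM : (fromBlocks CA P Pᵀ CB).PosDef) (x : Fin n → ℝ) :
    ∃ u v : Fin n → ℝ, CA *ᵥ u + P *ᵥ v = x ∧ Pᵀ *ᵥ u + CB *ᵥ v = x := by
  obtain ⟨z, hz⟩ := mulVec_surjective_iff_isUnit.2 hM.isUnit (Sum.elim x x)
  rw [fromBlocks_mulVec] at hz
  refine ⟨z ∘ Sum.inl, z ∘ Sum.inr, ?_, ?_⟩
  · ext i; simpa using congrFun hz (Sum.inl i)
  · ext i; simpa using congrFun hz (Sum.inr i)

lemma fusedCov_inv_mulVec {CA CB P : Matrix (Fin n) (Fin n) ℝ}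
    (hM : (fromBlocks CA P Pᵀ CB).PosDef) {x u v : Fin n → ℝ}
    (hu : CA *ᵥ u + P *ᵥ v = x) (hv : Pᵀ *ᵥ u + CB *ᵥ v = x) :
    (fusedCov CA CB P)⁻¹ *ᵥ x = u + v := by
  have hunit : IsUnit (fusedCov CA CB P) := by
    rw [← mulVec_surjective_iff_isUnit]
    intro y
    obtain ⟨u', v', hu', hv'⟩ := exists_joint_solution hM y
    exact ⟨u' + v', fusedCov_mulVec hM hu' hv'⟩
  rw [← fusedCov_mulVec hM hu hv, mulVec_mulVec,
    nonsing_inv_mul _ ((isUnit_iff_isUnit_det _).1 hunit), one_mulVec]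

lemma posDef_add_smul {P Q : Matrix (Fin n) (Fin n) ℝ} (hP : P.PosDef) (hQ : Q.PosDef)
    {ω : ℝ} (hω : 0 ≤ ω) : (P + ω • Q).PosDef :=
  hP.add_posSemidef (hQ.posSemidef.smul hω)

lemma add_smul_mulVec_inv_mulVec {P Q : Matrix (Fin n) (Fin n) ℝ} (hP : P.PosDef)
    (hQ : Q.PosDef) {ω : ℝ} (hω : 0 ≤ ω) (x : Fin n → ℝ) :
    P *ᵥ ((P + ω • Q)⁻¹ *ᵥ x) + ω • Q *ᵥ ((P + ω • Q)⁻¹ *ᵥ x) = x := by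
  have h := (isUnit_iff_isUnit_det _).1 (posDef_add_smul hP hQ hω).isUnit
  rw [← smul_mulVec, ← add_mulVec, mulVec_mulVec, mul_nonsing_inv _ h, one_mulVec]

/-- Weak duality: every split bound is below every admissible fused information. -/
lemma split_information_le {PA PB QA QB P : Matrix (Fin n) (Fin n) ℝ}
    (hPA : PA.PosDef) (hPB : PB.PosDef) (hQA : QA.PosDef) (hQB : QB.PosDef)
    (hP : (fromBlocks PA P Pᵀ PB).PosSemidef) {ω : ℝ} (h0 : 0 ≤ ω) (h1 : ω ≤ 1)
    {x a b : Fin n → ℝ} (ha : PA *ᵥ a + ω • QA *ᵥ a = x)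
    (hb : PB *ᵥ b + (1 - ω) • QB *ᵥ b = x) :
    x ⬝ᵥ (ω • a + (1 - ω) • b) ≤ x ⬝ᵥ (fusedCov (PA + QA) (PB + QB) P)⁻¹ *ᵥ x := by
  have hM := posDef_fromBlocks_add hQA hQB hP
  obtain ⟨u, v, hu, hv⟩ := exists_joint_solution hM x
  rw [fusedCov_inv_mulVec hM hu hv]
  have hsq := hM.posSemidef.dotProduct_mulVec_nonneg
    (Sum.elim (u - ω • a) (v - (1 - ω) • b))
  have hab := (posSemidef_fromBlocks_iff hPA.isHermitian hPB.isHermitian P).1 hP a (-b)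
  have hw : 0 ≤ ω * (1 - ω) := mul_nonneg h0 (by linarith)
  have hab' := mul_nonneg hw hab
  have eu := congrArg (fun w => u ⬝ᵥ w) hu
  have ev := congrArg (fun w => v ⬝ᵥ w) hv
  have eua := congrArg (fun w => a ⬝ᵥ w) hu
  have evb := congrArg (fun w => b ⬝ᵥ w) hv
  have ea := congrArg (fun w => a ⬝ᵥ w) ha
  have eb := congrArg (fun w => b ⬝ᵥ w) hb
  have s1 := dotProduct_mulVec_comm hPA.isHermitian u a
  have s2 := dotProduct_mulVec_comm hQA.isHermitian u a
  have s3 := dotProduct_mulVec_comm hPB.isHermitian v b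
  have s4 := dotProduct_mulVec_comm hQB.isHermitian v b
  rw [star_trivial, quadratic_fromBlocks] at hsq
  rw [dotProduct_comm x, dotProduct_comm x]
  simp only [add_mulVec, mulVec_sub, mulVec_smul, mulVec_neg,
    dotProduct_add, add_dotProduct, dotProduct_sub, sub_dotProduct, dotProduct_smul,
    smul_dotProduct, dotProduct_neg, neg_dotProduct, smul_eq_mul,
    dotProduct_transpose_mulVec_swap] at *
  rw [s1, s2, s3, s4] at hsq
  linear_combination hsq + hab' + eu + ev - 2 * ω * eua - 2 * (1 - ω) * evb + ω * ea
    + (1 - ω) * eb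

lemma sq_dotProduct_mulVec_le {P : Matrix (Fin n) (Fin n) ℝ} (hP : P.PosDef)
    {a : Fin n → ℝ} {r : ℝ} (hr : 0 < r) (ha : a ⬝ᵥ P *ᵥ a ≤ r) (c : Fin n → ℝ) :
    (c ⬝ᵥ P *ᵥ a) ^ 2 ≤ r * (c ⬝ᵥ P *ᵥ c) := by
  have h := quadratic_nonneg hP (r • c - (c ⬝ᵥ P *ᵥ a) • a)
  simp only [mulVec_sub, mulVec_smul, dotProduct_sub, sub_dotProduct, dotProduct_smul,
    smul_dotProduct, smul_eq_mul, dotProduct_mulVec_comm hP.isHermitian a c] at h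
  have h2 := mul_le_mul_of_nonneg_left ha (sq_nonneg (c ⬝ᵥ P *ᵥ a))
  refine le_of_mul_le_mul_left ?_ hr
  nlinarith

/-- The rank-one cross-covariance aligned with the directions `a` and `b`. -/
noncomputable def rankOneCross (PA PB : Matrix (Fin n) (Fin n) ℝ) (a b : Fin n → ℝ) (r : ℝ) :
    Matrix (Fin n) (Fin n) ℝ :=
  r⁻¹ • vecMulVec (PA *ᵥ a) (PB *ᵥ b)

lemma rankOneCross_mulVec (PA PB : Matrix (Fin n) (Fin n) ℝ) (a b c : Fin n → ℝ) (r : ℝ) :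
    rankOneCross PA PB a b r *ᵥ c = (r⁻¹ * (c ⬝ᵥ PB *ᵥ b)) • PA *ᵥ a := by
  rw [rankOneCross, smul_mulVec, vecMulVec_mulVec, dotProduct_comm]
  ext i
  simp [mul_assoc]

lemma rankOneCross_transpose (PA PB : Matrix (Fin n) (Fin n) ℝ) (a b : Fin n → ℝ) (r : ℝ) :
    (rankOneCross PA PB a b r)ᵀ = rankOneCross PB PA b a r := by
  rw [rankOneCross, rankOneCross, transpose_smul, transpose_vecMulVec]

lemma posSemidef_rankOneCross {PA PB : Matrix (Fin n) (Fin n) ℝ} (hPA : PA.PosDef)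
    (hPB : PB.PosDef) {a b : Fin n → ℝ} {r : ℝ} (hr : 0 < r)
    (ha : a ⬝ᵥ PA *ᵥ a ≤ r) (hb : b ⬝ᵥ PB *ᵥ b ≤ r) :
    (fromBlocks PA (rankOneCross PA PB a b r) (rankOneCross PA PB a b r)ᵀ PB).PosSemidef := by
  rw [posSemidef_fromBlocks_iff hPA.isHermitian hPB.isHermitian]
  intro c d
  have h1 := sq_dotProduct_mulVec_le hPA hr ha c
  have h2 := sq_dotProduct_mulVec_le hPB hr hb d
  rw [rankOneCross_mulVec, dotProduct_smul, smul_eq_mul]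
  refine nonneg_of_mul_nonneg_right (a := r) ?_ hr
  have h3 : r * (c ⬝ᵥ PA *ᵥ c + 2 * (r⁻¹ * (d ⬝ᵥ PB *ᵥ b) * (c ⬝ᵥ PA *ᵥ a))
      + d ⬝ᵥ PB *ᵥ d) = r * (c ⬝ᵥ PA *ᵥ c) + 2 * ((d ⬝ᵥ PB *ᵥ b) * (c ⬝ᵥ PA *ᵥ a))
      + r * (d ⬝ᵥ PB *ᵥ d) := by
    field_simp
  rw [h3]
  nlinarith [sq_nonneg (c ⬝ᵥ PA *ᵥ a + d ⬝ᵥ PB *ᵥ b)]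

lemma continuousOn_quadratic_inv {P Q : Matrix (Fin n) (Fin n) ℝ} (hP : P.PosDef)
    (hQ : Q.PosDef) (x : Fin n → ℝ) :
    ContinuousOn (fun ω : ℝ => ((P + ω • Q)⁻¹ *ᵥ x) ⬝ᵥ P *ᵥ ((P + ω • Q)⁻¹ *ᵥ x))
      (Set.Ici 0) := by
  have hlin : Continuous fun ω : ℝ => P + ω • Q := by fun_prop
  have hinv : ContinuousOn (fun ω : ℝ => (P + ω • Q)⁻¹) (Set.Ici 0) := by
    simp only [inv_def, Ring.inverse_eq_inv']
    refine ContinuousOn.smul (ContinuousOn.inv₀ hlin.matrix_det.continuousOn ?_)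
      hlin.matrix_adjugate.continuousOn
    intro ω hω
    exact (posDef_add_smul hP hQ hω).det_pos.ne'
  have hquad : Continuous fun M : Matrix (Fin n) (Fin n) ℝ => (M *ᵥ x) ⬝ᵥ P *ᵥ (M *ᵥ x) := by
    fun_prop
  exact hquad.comp_continuousOn hinv

/-- A zero of a continuous function on `[0, 1]`, or an endpoint with the matching sign. -/
lemma exists_balanced {f g : ℝ → ℝ} (hf : ContinuousOn f (Set.Icc 0 1))
    (hg : ContinuousOn g (Set.Icc 0 1)) :
    ∃ ω ∈ Set.Icc (0 : ℝ) 1, ω * f ω = ω * max (f ω) (g ω) ∧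
      (1 - ω) * g ω = (1 - ω) * max (f ω) (g ω) := by
  by_cases h1 : g 1 ≤ f 1
  · exact ⟨1, by simp, by simp [h1], by simp⟩
  by_cases h0 : f 0 ≤ g 0
  · exact ⟨0, by simp, by simp, by simp [h0]⟩
  push Not at h0 h1
  obtain ⟨ω, hω, h⟩ := intermediate_value_Icc' zero_le_one (hf.sub hg)
    (show (0 : ℝ) ∈ Set.Icc (f 1 - g 1) (f 0 - g 0) from ⟨by linarith, by linarith⟩)
  have h' : f ω = g ω := sub_eq_zero.1 h
  exact ⟨ω, hω, by simp [h'], by simp [h']⟩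

end SplitCovariance

open SplitCovariance

theorem sci_stmt13 {n : ℕ} (PA PB QA QB : Matrix (Fin n) (Fin n) ℝ)
    (hPA : PA.PosDef) (hPB : PB.PosDef) (hQA : QA.PosDef) (hQB : QB.PosDef)
    (x : Fin n → ℝ) (hx : x ≠ 0) :
    let CA := PA + QA
    let CB := PB + QB
    let CFs := fun (PAB : Matrix (Fin n) (Fin n) ℝ) =>
      CA - (CA - PAB) * (CA + CB - PAB - PABᵀ)⁻¹ * (CA - PABᵀ)
    let HSCI := fun (ω : ℝ) =>
      ω • (PA + ω • QA)⁻¹ + (1 - ω) • (PB + (1 - ω) • QB)⁻¹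
    ∃ v : ℝ,
      IsLeast {t : ℝ | ∃ PAB : Matrix (Fin n) (Fin n) ℝ,
        (Matrix.fromBlocks PA PAB PABᵀ PB).PosSemidef ∧
        t = x ⬝ᵥ (CFs PAB)⁻¹ *ᵥ x} v ∧
      IsGreatest {t : ℝ | ∃ ω ∈ Set.Icc (0 : ℝ) 1,
        t = x ⬝ᵥ (HSCI ω) *ᵥ x} v := by
  intro CA CB CFs HSCI
  have hH (ω : ℝ) : HSCI ω *ᵥ x
      = ω • ((PA + ω • QA)⁻¹ *ᵥ x) + (1 - ω) • ((PB + (1 - ω) • QB)⁻¹ *ᵥ x) := by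
    simp only [HSCI, add_mulVec, smul_mulVec]
  have hweak : ∀ P : Matrix (Fin n) (Fin n) ℝ, (fromBlocks PA P Pᵀ PB).PosSemidef →
      ∀ ω ∈ Set.Icc (0 : ℝ) 1, x ⬝ᵥ HSCI ω *ᵥ x ≤ x ⬝ᵥ (CFs P)⁻¹ *ᵥ x := by
    intro P hP ω hω
    rw [hH]
    exact split_information_le hPA hPB hQA hQB hP hω.1 hω.2
      (add_smul_mulVec_inv_mulVec hPA hQA hω.1 x)
      (add_smul_mulVec_inv_mulVec hPB hQB (sub_nonneg.2 hω.2) x)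
  suffices hstrong : ∃ P : Matrix (Fin n) (Fin n) ℝ, (fromBlocks PA P Pᵀ PB).PosSemidef ∧
      ∃ ω ∈ Set.Icc (0 : ℝ) 1, (CFs P)⁻¹ *ᵥ x = HSCI ω *ᵥ x by
    obtain ⟨P, hP, ω, hω, h⟩ := hstrong
    refine ⟨x ⬝ᵥ HSCI ω *ᵥ x, ⟨⟨P, hP, by rw [h]⟩, ?_⟩, ⟨ω, hω, rfl⟩, ?_⟩
    · rintro _ ⟨P', hP', rfl⟩
      exact hweak P' hP' ω hω
    · rintro _ ⟨ω', hω', rfl⟩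
      rw [← h]
      exact hweak P hP ω' hω'
  obtain ⟨ω, hω, hf, hg⟩ := exists_balanced
    ((continuousOn_quadratic_inv hPA hQA x).mono Set.Icc_subset_Ici_self)
    ((continuousOn_quadratic_inv hPB hQB x).comp (t := Set.Ici (0 : ℝ)) (f := fun ω => 1 - ω)
      (by fun_prop) fun ω hω => sub_nonneg.2 hω.2)
  have ha := add_smul_mulVec_inv_mulVec hPA hQA hω.1 x
  have hb := add_smul_mulVec_inv_mulVec hPB hQB (sub_nonneg.2 hω.2) x
  have hHω := hH ω
  simp only [Function.comp_apply] at hf hg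
  generalize (PA + ω • QA)⁻¹ *ᵥ x = a at *
  generalize (PB + (1 - ω) • QB)⁻¹ *ᵥ x = b at *
  have hane : a ≠ 0 := by
    rintro rfl
    exact hx (by simpa using ha.symm)
  set r := max (a ⬝ᵥ PA *ᵥ a) (b ⬝ᵥ PB *ᵥ b) with hr_def
  have hr : 0 < r := lt_max_of_lt_left (quadratic_pos hPA hane)
  have hP := posSemidef_rankOneCross hPA hPB hr (le_max_left _ _ : a ⬝ᵥ PA *ᵥ a ≤ r)
    (le_max_right _ _ : b ⬝ᵥ PB *ᵥ b ≤ r)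
  refine ⟨_, hP, ω, hω, ?_⟩
  rw [hHω]
  refine fusedCov_inv_mulVec (posDef_fromBlocks_add hQA hQB hP) ?_ ?_
  · have hc : r⁻¹ * ((1 - ω) * (b ⬝ᵥ PB *ᵥ b)) = 1 - ω := by
      rw [hg]
      field_simp
    rw [rankOneCross_mulVec, smul_dotProduct, smul_eq_mul, hc, ← ha, add_mulVec]
    simp only [mulVec_smul]
    module
  · have hc : r⁻¹ * (ω * (a ⬝ᵥ PA *ᵥ a)) = ω := by
      rw [hf]
      field_simp
    rw [rankOneCross_transpose, rankOneCross_mulVec, smul_dotProduct, smul_eq_mul, hc, ← hb,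
      add_mulVec]
    simp only [mulVec_smul]
    module
end

section
/- (Theorem 3, forward direction.) In the SCI setting, if an ellipsoid E(B) = {x : xᵀ B^{-1} x ≤ 1} tightly circumscribes V* = ∩_{ω∈[0,1]} E(B_SCI(ω)) (i.e., V* ⊆ E(B) and no ellipsoid E(Q) with V* ⊆ E(Q) ⊆ E(B) and Q ≠ B exists), then B = B_SCI(ω₁) for some ω₁ ∈ [0,1]. -/
open Matrix

section QuadraticPencil

variable {n : ℕ} {D : ℝ → Matrix (Fin n) (Fin n) ℝ}

/-- Two vectors whose quadratic forms along a matrix curve are each nonnegative somewhere on `[0, 1]`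
have a common parameter of nonnegativity, provided this holds for every vector
and the sets of such parameters are all convex. -/
lemma exists_common_nonneg_of_le
    (hcont : ∀ u v, ContinuousOn (fun ω => u ⬝ᵥ D ω *ᵥ v) (Set.Icc 0 1))
    (hconv : ∀ x, Convex ℝ {ω ∈ Set.Icc (0 : ℝ) 1 | 0 ≤ x ⬝ᵥ D ω *ᵥ x})
    (hne : ∀ x, ∃ ω ∈ Set.Icc (0 : ℝ) 1, 0 ≤ x ⬝ᵥ D ω *ᵥ x)
    {x y : Fin n → ℝ} {a b : ℝ} (hab : a ≤ b)
    (ha : a ∈ Set.Icc (0 : ℝ) 1) (hxa : 0 ≤ x ⬝ᵥ D a *ᵥ x)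
    (hb : b ∈ Set.Icc (0 : ℝ) 1) (hyb : 0 ≤ y ⬝ᵥ D b *ᵥ y) :
    ∃ ω ∈ Set.Icc (0 : ℝ) 1, 0 ≤ x ⬝ᵥ D ω *ᵥ x ∧ 0 ≤ y ⬝ᵥ D ω *ᵥ y := by
  by_contra! hdisj
  have hclosed : ∀ z, IsClosed {ω ∈ Set.Icc (0 : ℝ) 1 | 0 ≤ z ⬝ᵥ D ω *ᵥ z} := fun z =>
    (hcont z z).preimage_isClosed_of_isClosed isClosed_Icc isClosed_Ici
  have hsub : Set.Icc a b ⊆ Set.Icc 0 1 := Set.Icc_subset_Icc ha.1 hb.2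
  obtain ⟨c, hc, hxc, hyc⟩ : ∃ c ∈ Set.Icc a b, x ⬝ᵥ D c *ᵥ x < 0 ∧ y ⬝ᵥ D c *ᵥ y < 0 := by
    by_contra! hcov
    obtain ⟨ω, -, h1, h2⟩ := isPreconnected_closed_iff.1 (isPreconnected_Icc (a := a) (b := b))
      _ _ (hclosed x) (hclosed y)
      (fun ω hω => by
        by_cases h : 0 ≤ x ⬝ᵥ D ω *ᵥ x
        · exact Or.inl ⟨hsub hω, h⟩
        · exact Or.inr ⟨hsub hω, hcov ω hω (not_le.1 h)⟩)
      ⟨a, ⟨le_rfl, hab⟩, ha, hxa⟩ ⟨b, ⟨hab, le_rfl⟩, hb, hyb⟩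
    exact absurd h2.2 (not_le.2 (hdisj ω h1.1 h1.2))
  obtain ⟨w, hw, hcross⟩ : ∃ w : Fin n → ℝ, (∀ ω, w ⬝ᵥ D ω *ᵥ w = y ⬝ᵥ D ω *ᵥ y) ∧
      x ⬝ᵥ D c *ᵥ w + w ⬝ᵥ D c *ᵥ x ≤ 0 := by
    rcases le_total (x ⬝ᵥ D c *ᵥ y + y ⬝ᵥ D c *ᵥ x) 0 with h | h
    · exact ⟨y, fun _ => rfl, h⟩
    · refine ⟨-y, fun _ => by simp [mulVec_neg], ?_⟩
      simp only [mulVec_neg, dotProduct_neg, neg_dotProduct]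
      linarith
  set F : ℝ × ℝ → ℝ := fun p =>
    ((1 - p.1) • x + p.1 • w) ⬝ᵥ D p.2 *ᵥ ((1 - p.1) • x + p.1 • w) with hF
  have hFexp : ∀ p, F p = (1 - p.1) ^ 2 * (x ⬝ᵥ D p.2 *ᵥ x)
      + (1 - p.1) * p.1 * (x ⬝ᵥ D p.2 *ᵥ w + w ⬝ᵥ D p.2 *ᵥ x)
      + p.1 ^ 2 * (w ⬝ᵥ D p.2 *ᵥ w) := by
    intro p
    simp only [hF, mulVec_add, mulVec_smul, dotProduct_add, add_dotProduct, smul_dotProduct,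
      dotProduct_smul, smul_eq_mul]
    ring
  have hFcont : ContinuousOn F (Set.Icc 0 1 ×ˢ Set.Icc 0 1) := by
    have key : ∀ u v : Fin n → ℝ, ContinuousOn (fun p : ℝ × ℝ => u ⬝ᵥ D p.2 *ᵥ v)
        (Set.Icc 0 1 ×ˢ Set.Icc 0 1) := fun u v =>
      (hcont u v).comp continuousOn_snd fun p hp => hp.2
    rw [funext hFexp]
    have := key x x
    have := key x w
    have := key w x
    have := key w w
    fun_prop
  have hFneg : ∀ t ∈ Set.Icc (0 : ℝ) 1, F (t, c) < 0 := by
    intro t ht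
    rw [hFexp]
    have h1 : (1 - t) * t * (x ⬝ᵥ D c *ᵥ w + w ⬝ᵥ D c *ᵥ x) ≤ 0 :=
      mul_nonpos_of_nonneg_of_nonpos (mul_nonneg (by linarith [ht.2]) ht.1) hcross
    have hwc : w ⬝ᵥ D c *ᵥ w < 0 := by rwa [hw]
    rcases ht.1.eq_or_lt with h | h
    · simp only [← h]
      nlinarith
    · have h2 : t ^ 2 * (w ⬝ᵥ D c *ᵥ w) < 0 := mul_neg_of_pos_of_neg (by positivity) hwc
      have h3 : (1 - t) ^ 2 * (x ⬝ᵥ D c *ᵥ x) ≤ 0 :=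
        mul_nonpos_of_nonneg_of_nonpos (by positivity) hxc.le
      linarith
  have hproj : ∀ l r, Set.Icc l r ⊆ Set.Icc (0 : ℝ) 1 →
      IsClosed (Prod.fst '' {p ∈ Set.Icc (0 : ℝ) 1 ×ˢ Set.Icc l r | 0 ≤ F p}) := by
    intro l r hlr
    have hcl : IsClosed {p ∈ Set.Icc (0 : ℝ) 1 ×ˢ Set.Icc l r | 0 ≤ F p} :=
      (hFcont.mono (Set.prod_mono_right hlr)).preimage_isClosed_of_isClosed
        (isClosed_Icc.prod isClosed_Icc) isClosed_Ici
    exact (((isCompact_Icc.prod isCompact_Icc).of_isClosed_subset hcl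
      fun p hp => hp.1).image continuous_fst).isClosed
  have hc01 := hsub hc
  obtain ⟨t, -, ⟨⟨t₁, p⟩, hp, rfl⟩, ⟨⟨t₂, q⟩, hq, hqt⟩⟩ :=
    isPreconnected_closed_iff.1 (isPreconnected_Icc (a := (0 : ℝ)) (b := 1))
      _ _ (hproj 0 c (Set.Icc_subset_Icc le_rfl hc01.2))
      (hproj c 1 (Set.Icc_subset_Icc hc01.1 le_rfl))
      (fun t ht => by
        obtain ⟨ω, hω, h⟩ := hne ((1 - t) • x + t • w)
        rcases le_total ω c with h' | h'
        · exact Or.inl ⟨(t, ω), ⟨⟨ht, hω.1, h'⟩, h⟩, rfl⟩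
        · exact Or.inr ⟨(t, ω), ⟨⟨ht, h', hω.2⟩, h⟩, rfl⟩)
      ⟨0, by simp, (0, a), ⟨⟨by simp, ha.1, hc.1⟩, by simpa [hF] using hxa⟩, rfl⟩
      ⟨1, by simp, (1, b), ⟨⟨by simp, hc.2, hb.2⟩, by simpa [hF, hw] using hyb⟩, rfl⟩
  simp only at hqt
  subst hqt
  have hmem := (hconv ((1 - t₂) • x + t₂ • w)).ordConnected.out
    ⟨⟨hp.1.2.1, hp.1.2.2.trans hc01.2⟩, hp.2⟩ ⟨⟨hc01.1.trans hq.1.2.1, hq.1.2.2⟩, hq.2⟩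
    ⟨hp.1.2.2, hq.1.2.1⟩
  exact absurd hmem.2 (not_le.2 (hFneg t₂ hp.1.1))

/-- A lossless S-procedure for one-parameter matrix curves. -/
lemma exists_forall_nonneg
    (hcont : ∀ u v, ContinuousOn (fun ω => u ⬝ᵥ D ω *ᵥ v) (Set.Icc 0 1))
    (hconv : ∀ x, Convex ℝ {ω ∈ Set.Icc (0 : ℝ) 1 | 0 ≤ x ⬝ᵥ D ω *ᵥ x})
    (hne : ∀ x, ∃ ω ∈ Set.Icc (0 : ℝ) 1, 0 ≤ x ⬝ᵥ D ω *ᵥ x) :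
    ∃ ω ∈ Set.Icc (0 : ℝ) 1, ∀ x, 0 ≤ x ⬝ᵥ D ω *ᵥ x := by
  have hpair : ∀ x y, ∃ ω ∈ Set.Icc (0 : ℝ) 1, 0 ≤ x ⬝ᵥ D ω *ᵥ x ∧ 0 ≤ y ⬝ᵥ D ω *ᵥ y := by
    intro x y
    obtain ⟨a, ha, hxa⟩ := hne x
    obtain ⟨b, hb, hyb⟩ := hne y
    rcases le_total a b with h | h
    · exact exists_common_nonneg_of_le hcont hconv hne h ha hxa hb hyb
    · obtain ⟨ω, hω, h1, h2⟩ := exists_common_nonneg_of_le hcont hconv hne h hb hyb ha hxa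
      exact ⟨ω, hω, h2, h1⟩
  obtain ⟨ω, hω⟩ := Convex.helly_theorem_compact' (𝕜 := ℝ)
    (F := fun x => {ω ∈ Set.Icc (0 : ℝ) 1 | 0 ≤ x ⬝ᵥ D ω *ᵥ x}) hconv
    (fun x => isCompact_Icc.of_isClosed_subset
      ((hcont x x).preimage_isClosed_of_isClosed isClosed_Icc isClosed_Ici) fun _ h => h.1)
    (fun I hI => by
      obtain ⟨x, y, hxy⟩ : ∃ x y, I ⊆ {x, y} := by
        rw [Module.finrank_self] at hI
        rcases Nat.lt_or_ge I.card 2 with h | h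
        · obtain ⟨x, hx⟩ := Finset.card_le_one_iff_subset_singleton.1 (Nat.le_of_lt_succ h)
          exact ⟨x, x, by simpa using hx⟩
        · obtain ⟨x, y, -, h⟩ := Finset.card_eq_two.1 (le_antisymm hI h)
          exact ⟨x, y, h.le⟩
      obtain ⟨ω, hω, h1, h2⟩ := hpair x y
      refine ⟨ω, Set.mem_iInter₂.2 fun z hz => ⟨hω, ?_⟩⟩
      rcases Finset.mem_insert.1 (hxy hz) with rfl | h
      · exact h1
      · rwa [Finset.mem_singleton.1 h])
  rw [Set.mem_iInter] at hω
  exact ⟨ω, (hω 0).1, fun x => (hω x).2⟩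

end QuadraticPencil

section ParallelSum

variable {n : ℕ} {P Q : Matrix (Fin n) (Fin n) ℝ}

lemma posDef_add_smul (hP : P.PosDef) (hQ : Q.PosDef) {ω : ℝ} (hω : 0 ≤ ω) :
    (P + ω • Q).PosDef :=
  hP.add_posSemidef (hQ.posSemidef.smul hω)

lemma continuousAt_smul_inv_add_smul (hP : P.PosDef) (hQ : Q.PosDef) {ω : ℝ} (hω : 0 ≤ ω) :
    ContinuousAt (fun t : ℝ => t • (P + t • Q)⁻¹) ω := by
  have hdet : (P + ω • Q).det ≠ 0 := (posDef_add_smul hP hQ hω).det_pos.ne'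
  have hinv : ContinuousAt Inv.inv (P + ω • Q) := by
    refine continuousAt_matrix_inv _ ?_
    rw [Ring.inverse_eq_inv']
    exact continuousAt_inv₀ hdet
  have hlin : ContinuousAt (fun t : ℝ => P + t • Q) ω := by fun_prop
  exact continuousAt_id.smul (ContinuousAt.comp (f := fun t : ℝ => P + t • Q) hinv hlin)

lemma two_mul_dotProduct_sub_le (hP : P.PosDef) (u w : Fin n → ℝ) :
    2 * (u ⬝ᵥ w) - w ⬝ᵥ P *ᵥ w ≤ u ⬝ᵥ P⁻¹ *ᵥ u := by
  have hdet : IsUnit P.det := hP.det_pos.ne'.isUnit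
  have h := hP.inv.posSemidef.dotProduct_mulVec_nonneg (u - P *ᵥ w)
  have hsymm : (P *ᵥ w) ⬝ᵥ P⁻¹ *ᵥ u = u ⬝ᵥ w := by
    have hPt : P⁻¹ᵀ = P⁻¹ := by simpa using hP.inv.isHermitian.eq
    rw [dotProduct_mulVec, ← mulVec_transpose, hPt, mulVec_mulVec, nonsing_inv_mul _ hdet,
      one_mulVec, dotProduct_comm]
  simp only [star_trivial, mulVec_sub, sub_dotProduct, dotProduct_sub, mulVec_mulVec,
    nonsing_inv_mul _ hdet, one_mulVec, hsymm] at h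
  rw [dotProduct_comm (P *ᵥ w) w] at h
  linarith

lemma concaveOn_smul_inv_add_smul (hP : P.PosDef) (hQ : Q.PosDef) (x : Fin n → ℝ) :
    ConcaveOn ℝ (Set.Ici 0) fun ω : ℝ => x ⬝ᵥ (ω • (P + ω • Q)⁻¹) *ᵥ x := by
  have hsolve : ∀ θ ∈ Set.Ici (0 : ℝ), ∃ w, (P + θ • Q)⁻¹ *ᵥ x = w ∧
      x = P *ᵥ w + θ • Q *ᵥ w ∧ x ⬝ᵥ w = w ⬝ᵥ P *ᵥ w + θ * (w ⬝ᵥ Q *ᵥ w) := by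
    intro θ hθ
    have hdet := (posDef_add_smul hP hQ hθ).det_pos.ne'.isUnit
    obtain ⟨w, hw⟩ : ∃ w, (P + θ • Q)⁻¹ *ᵥ x = w := ⟨_, rfl⟩
    have hx : x = P *ᵥ w + θ • Q *ᵥ w := by
      rw [← hw, ← smul_mulVec, ← add_mulVec, mulVec_mulVec, mul_nonsing_inv _ hdet, one_mulVec]
    have hxw : x ⬝ᵥ w = w ⬝ᵥ P *ᵥ w + θ * (w ⬝ᵥ Q *ᵥ w) := by
      rw [dotProduct_comm]
      conv_lhs => rw [hx]
      simp [dotProduct_add, dotProduct_smul]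
    exact ⟨w, hw, hx, hxw⟩
  have hbound : ∀ θ ∈ Set.Ici (0 : ℝ), ∀ u, x ⬝ᵥ (θ • (P + θ • Q)⁻¹) *ᵥ x ≤
      θ * (u ⬝ᵥ P⁻¹ *ᵥ u) + (x - u) ⬝ᵥ Q⁻¹ *ᵥ (x - u) := by
    intro θ hθ u
    obtain ⟨w, hw, hx, hxw⟩ := hsolve θ hθ
    have hu := mul_le_mul_of_nonneg_left (two_mul_dotProduct_sub_le hP u w) hθ
    have hv := two_mul_dotProduct_sub_le hQ (x - u) (θ • w)
    rw [smul_mulVec, hw, dotProduct_smul, smul_eq_mul]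
    simp only [mulVec_smul, dotProduct_smul, smul_dotProduct, sub_dotProduct _ _ w, smul_eq_mul]
      at hv
    have : θ * (x ⬝ᵥ w) = θ * (w ⬝ᵥ P *ᵥ w + θ * (w ⬝ᵥ Q *ᵥ w)) := by rw [hxw]
    linarith
  have hattain : ∀ θ ∈ Set.Ici (0 : ℝ), ∃ u, x ⬝ᵥ (θ • (P + θ • Q)⁻¹) *ᵥ x =
      θ * (u ⬝ᵥ P⁻¹ *ᵥ u) + (x - u) ⬝ᵥ Q⁻¹ *ᵥ (x - u) := by
    intro θ hθ
    obtain ⟨w, hw, hx, hxw⟩ := hsolve θ hθ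
    refine ⟨P *ᵥ w, ?_⟩
    have hv : x - P *ᵥ w = θ • Q *ᵥ w := by
      conv_lhs => rw [hx]
      simp
    rw [hv, smul_mulVec, hw, dotProduct_smul, smul_eq_mul, hxw]
    simp only [mulVec_smul, mulVec_mulVec, nonsing_inv_mul _ hP.det_pos.ne'.isUnit,
      nonsing_inv_mul _ hQ.det_pos.ne'.isUnit, one_mulVec, dotProduct_smul, smul_dotProduct,
      smul_eq_mul, dotProduct_comm (P *ᵥ w) w, dotProduct_comm (Q *ᵥ w) w]
    ring
  refine ⟨convex_Ici 0, fun α hα β hβ a b ha hb hab => ?_⟩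
  obtain ⟨u, hu⟩ := hattain (a • α + b • β) (convex_Ici 0 hα hβ ha hb hab)
  simp only [smul_eq_mul] at hu ⊢
  rw [hu]
  have h1 := mul_le_mul_of_nonneg_left (hbound α hα u) ha
  have h2 := mul_le_mul_of_nonneg_left (hbound β hβ u) hb
  have h3 : (a + b) * ((x - u) ⬝ᵥ Q⁻¹ *ᵥ (x - u)) = (x - u) ⬝ᵥ Q⁻¹ *ᵥ (x - u) := by
    rw [hab, one_mul]
  linarith

end ParallelSum

section SplitCovariance

variable {n : ℕ} {PA PB QA QB : Matrix (Fin n) (Fin n) ℝ}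

/-- The information matrix `B_SCI(ω)⁻¹` of split covariance intersection. -/
noncomputable def sciInfo (PA PB QA QB : Matrix (Fin n) (Fin n) ℝ) (ω : ℝ) : Matrix (Fin n) (Fin n) ℝ :=
  ω • (PA + ω • QA)⁻¹ + (1 - ω) • (PB + (1 - ω) • QB)⁻¹

lemma posDef_sciInfo (hPA : PA.PosDef) (hPB : PB.PosDef) (hQA : QA.PosDef) (hQB : QB.PosDef)
    {ω : ℝ} (hω : ω ∈ Set.Icc (0 : ℝ) 1) : (sciInfo PA PB QA QB ω).PosDef := by
  have h1 : 0 ≤ 1 - ω := sub_nonneg.2 hω.2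
  have hA := (posDef_add_smul hPA hQA hω.1).inv
  have hB := (posDef_add_smul hPB hQB h1).inv
  rcases hω.1.eq_or_lt with h | h
  · exact PosDef.posSemidef_add (hA.posSemidef.smul hω.1) (hB.smul (by linarith))
  · exact (hA.smul h).add_posSemidef (hB.posSemidef.smul h1)

lemma continuousOn_sciInfo (hPA : PA.PosDef) (hPB : PB.PosDef) (hQA : QA.PosDef)
    (hQB : QB.PosDef) : ContinuousOn (sciInfo PA PB QA QB) (Set.Icc 0 1) := by
  intro ω hω
  refine ContinuousAt.continuousWithinAt ?_
  have h1 : ContinuousAt (fun t : ℝ => 1 - t) ω := by fun_prop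
  exact (continuousAt_smul_inv_add_smul hPA hQA hω.1).add
    (ContinuousAt.comp (f := fun t : ℝ => 1 - t)
      (continuousAt_smul_inv_add_smul hPB hQB (sub_nonneg.2 hω.2)) h1)

lemma concaveOn_sciInfo (hPA : PA.PosDef) (hPB : PB.PosDef) (hQA : QA.PosDef)
    (hQB : QB.PosDef) (x : Fin n → ℝ) :
    ConcaveOn ℝ (Set.Icc 0 1) fun ω => x ⬝ᵥ sciInfo PA PB QA QB ω *ᵥ x := by
  have hA := concaveOn_smul_inv_add_smul hPA hQA x
  have hB := concaveOn_smul_inv_add_smul hPB hQB x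
  refine ⟨convex_Icc 0 1, fun α hα β hβ a b ha hb hab => ?_⟩
  have h1 := hA.2 hα.1 hβ.1 ha hb hab
  have h2 := hB.2 (sub_nonneg.2 hα.2) (sub_nonneg.2 hβ.2) ha hb hab
  have h3 : a • (1 - α) + b • (1 - β) = 1 - (a • α + b • β) := by
    simp only [smul_eq_mul]
    linarith
  rw [h3] at h2
  simp only [sciInfo, add_mulVec, dotProduct_add, smul_add] at h1 h2 ⊢
  linarith

lemma exists_le_sciInfo (hPA : PA.PosDef) (hPB : PB.PosDef) (hQA : QA.PosDef) (hQB : QB.PosDef)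
    (C : Matrix (Fin n) (Fin n) ℝ)
    (hV : ∀ x : Fin n → ℝ, (∀ ω ∈ Set.Icc (0 : ℝ) 1, x ⬝ᵥ sciInfo PA PB QA QB ω *ᵥ x ≤ 1) →
      x ⬝ᵥ C *ᵥ x ≤ 1) :
    ∃ ω ∈ Set.Icc (0 : ℝ) 1, ∀ x, x ⬝ᵥ C *ᵥ x ≤ x ⬝ᵥ sciInfo PA PB QA QB ω *ᵥ x := by
  have hcont : ∀ u v, ContinuousOn (fun ω => u ⬝ᵥ sciInfo PA PB QA QB ω *ᵥ v) (Set.Icc 0 1) :=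
    fun u v => (show Continuous fun M : Matrix (Fin n) (Fin n) ℝ => u ⬝ᵥ M *ᵥ v by
      fun_prop).comp_continuousOn (continuousOn_sciInfo hPA hPB hQA hQB)
  obtain ⟨ω, hω, h⟩ := exists_forall_nonneg (D := fun ω => sciInfo PA PB QA QB ω - C)
    (fun u v => by
      simp only [sub_mulVec, dotProduct_sub]
      exact (hcont u v).sub continuousOn_const)
    (fun x => by
      simp only [sub_mulVec, dotProduct_sub, sub_nonneg]
      exact (concaveOn_sciInfo hPA hPB hQA hQB x).convex_ge _)
    (fun x => by
      simp only [sub_mulVec, dotProduct_sub, sub_nonneg]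
      rcases eq_or_ne x 0 with rfl | hx
      · exact ⟨0, by simp, by simp⟩
      obtain ⟨ω, hω, hmax⟩ := isCompact_Icc.exists_isMaxOn
        (Set.nonempty_Icc.2 (zero_le_one' ℝ)) (hcont x x)
      refine ⟨ω, hω, ?_⟩
      set m := x ⬝ᵥ sciInfo PA PB QA QB ω *ᵥ x
      have hm : 0 < m := by
        simpa using (posDef_sciInfo hPA hPB hQA hQB hω).dotProduct_mulVec_pos hx
      have hscale : ∀ M : Matrix (Fin n) (Fin n) ℝ,
          ((√m)⁻¹ • x) ⬝ᵥ M *ᵥ ((√m)⁻¹ • x) = (x ⬝ᵥ M *ᵥ x) / m := by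
        intro M
        simp only [mulVec_smul, dotProduct_smul, smul_dotProduct, smul_eq_mul]
        rw [← mul_assoc, ← mul_inv, Real.mul_self_sqrt hm.le, div_eq_inv_mul]
      have := hV ((√m)⁻¹ • x) fun t ht => by
        rw [hscale, div_le_one hm]
        exact hmax ht
      rwa [hscale, div_le_one hm] at this)
  refine ⟨ω, hω, fun x => ?_⟩
  have := h x
  simpa only [sub_mulVec, dotProduct_sub, sub_nonneg] using this

end SplitCovariance

theorem sci_stmt17 {n : ℕ} (PA PB QA QB : Matrix (Fin n) (Fin n) ℝ)
    (hPA : PA.PosDef) (hPB : PB.PosDef) (hQA : QA.PosDef) (hQB : QB.PosDef)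
    (B : Matrix (Fin n) (Fin n) ℝ) (hB : B.PosDef) :
    let BSCI := fun (ω : ℝ) =>
      (ω • (PA + ω • QA)⁻¹ + (1 - ω) • (PB + (1 - ω) • QB)⁻¹)⁻¹
    let E := fun (M : Matrix (Fin n) (Fin n) ℝ) =>
      {x : Fin n → ℝ | x ⬝ᵥ M⁻¹ *ᵥ x ≤ 1}
    let V := ⋂ ω ∈ Set.Icc (0 : ℝ) 1, E (BSCI ω)
    V ⊆ E B →
    (∀ Q : Matrix (Fin n) (Fin n) ℝ, Q.PosDef → V ⊆ E Q → E Q ⊆ E B → Q = B) →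
    ∃ ω₁ ∈ Set.Icc (0 : ℝ) 1, B = BSCI ω₁ := by
  intro BSCI E V hVB htight
  have hinv : ∀ ω ∈ Set.Icc (0 : ℝ) 1, (BSCI ω)⁻¹ = sciInfo PA PB QA QB ω := fun ω hω =>
    nonsing_inv_nonsing_inv _ (posDef_sciInfo hPA hPB hQA hQB hω).det_pos.ne'.isUnit
  obtain ⟨ω, hω, hle⟩ := exists_le_sciInfo hPA hPB hQA hQB B⁻¹ fun x hx =>
    hVB (Set.mem_iInter₂.2 fun ω hω => by
      change x ⬝ᵥ (BSCI ω)⁻¹ *ᵥ x ≤ 1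
      rw [hinv ω hω]
      exact hx ω hω)
  refine ⟨ω, hω, (htight (BSCI ω) (posDef_sciInfo hPA hPB hQA hQB hω).inv
    (Set.biInter_subset_of_mem hω) fun x hx => ?_).symm⟩
  change x ⬝ᵥ (BSCI ω)⁻¹ *ᵥ x ≤ 1 at hx
  rw [hinv ω hω] at hx
  exact (hle x).trans hx
end
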